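/- arXiv:1907.03640 — 2 statements merged into one kernel-verified Lean document; each statement's English description precedes it below -/
import Mathlib

section
/- Let n ∈ ℕ with n ≥ 1, let x ∈ ℝ with -1 ≤ x ≤ 1, let r ∈ ℕ with r ≥ 1 and u_1, …, u_r ∈ ℝ. Then the n-th derivative at t = 0 of t ↦ exp(x t + Σ_{j=1}^r u_j t^j) · sin(√(1-x²) · t) equals √(1-x²) · Σ_{j=0}^{n-1} (n choose j) · H_j(u, r) · U_{n-j-1}(x), where U_m denotes the Chebyshev polynomial of the second kind evaluated at x. (That is, P₂(n, x, √(1-x²), u, r) = √(1-x²) · P₄(n, x, u, r) with P₄(n, x, u, r) = Σ_{j} (n choose j) H_j(u, r) U_{n-j-1}(x).) -/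
open Finset

open Polynomial.Chebyshev in
/-- For `y ^ 2 = 1 - x ^ 2`, the derivatives of `t ↦ exp (x t) sin (y t)` are expressed through
the Chebyshev polynomials of both kinds evaluated at `x`. -/
theorem iteratedDeriv_exp_mul_sin {x y : ℝ} (hxy : y ^ 2 = 1 - x ^ 2) (m : ℕ) :
    iteratedDeriv m (fun t : ℝ => Real.exp (x * t) * Real.sin (y * t)) =
      fun t : ℝ => Real.exp (x * t) *
        (y * (U ℝ ((m : ℤ) - 1)).eval x * Real.cos (y * t) +
          (T ℝ m).eval x * Real.sin (y * t)) := by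
  induction m with
  | zero => simp
  | succ m ih =>
    rw [iteratedDeriv_succ, ih]
    funext t
    have hx : HasDerivAt (fun t : ℝ => x * t) x t := by
      simpa using (hasDerivAt_id t).const_mul x
    have hy : HasDerivAt (fun t : ℝ => y * t) y t := by
      simpa using (hasDerivAt_id t).const_mul y
    have h := hx.exp.fun_mul
      ((hy.cos.const_mul (y * (U ℝ ((m : ℤ) - 1)).eval x)).fun_add
        (hy.sin.const_mul ((T ℝ m).eval x)))
    rw [h.deriv]
    have hU := congrArg (Polynomial.eval x) (U_eq_X_mul_U_add_T ℝ ((m : ℤ) - 1))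
    have hT := congrArg (Polynomial.eval x) (T_eq_X_mul_T_sub_pol_U ℝ ((m : ℤ) - 1))
    rw [show (m : ℤ) - 1 + 2 = m + 1 by ring] at hT
    simp only [sub_add_cancel, Polynomial.eval_add, Polynomial.eval_sub, Polynomial.eval_mul,
      Polynomial.eval_pow, Polynomial.eval_one, Polynomial.eval_X] at hU hT
    push_cast
    rw [add_sub_cancel_right, hU, hT]
    linear_combination
      (-Real.exp (x * t) * (U ℝ ((m : ℤ) - 1)).eval x * Real.sin (y * t)) * hxy

theorem stmt_9 (n : ℕ) (hn : 1 ≤ n) (x : ℝ) (hx : -1 ≤ x) (hx' : x ≤ 1)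
    (r : ℕ) (hr : 1 ≤ r) (u : ℕ → ℝ) :
    iteratedDeriv n
      (fun t : ℝ => Real.exp (x * t + ∑ j ∈ Finset.Icc 1 r, u j * t ^ j) *
        Real.sin (Real.sqrt (1 - x ^ 2) * t)) 0
    = Real.sqrt (1 - x ^ 2) *
        ∑ j ∈ Finset.range n,
          (n.choose j : ℝ) *
            iteratedDeriv j (fun t : ℝ => Real.exp (∑ k ∈ Finset.Icc 1 r, u k * t ^ k)) 0 *
            (Polynomial.Chebyshev.U ℝ ((n : ℤ) - j - 1)).eval x := by
  have hy : Real.sqrt (1 - x ^ 2) ^ 2 = 1 - x ^ 2 := Real.sq_sqrt (by nlinarith)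
  have hfun : (fun t : ℝ => Real.exp (x * t + ∑ j ∈ Finset.Icc 1 r, u j * t ^ j) *
        Real.sin (Real.sqrt (1 - x ^ 2) * t)) =
      fun t : ℝ => Real.exp (∑ j ∈ Finset.Icc 1 r, u j * t ^ j) *
        (Real.exp (x * t) * Real.sin (Real.sqrt (1 - x ^ 2) * t)) := by
    funext t
    rw [Real.exp_add]
    ring
  have hf : ContDiff ℝ n (fun t : ℝ => Real.exp (∑ j ∈ Finset.Icc 1 r, u j * t ^ j)) := by
    fun_prop
  have hg : ContDiff ℝ n
      (fun t : ℝ => Real.exp (x * t) * Real.sin (Real.sqrt (1 - x ^ 2) * t)) := by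
    fun_prop
  rw [hfun, iteratedDeriv_fun_mul hf.contDiffAt hg.contDiffAt, Finset.sum_range_succ,
    Finset.mul_sum]
  simp only [iteratedDeriv_exp_mul_sin hy]
  simp only [mul_zero, Real.exp_zero, Real.cos_zero, Real.sin_zero, mul_one, one_mul, add_zero,
    Nat.sub_self, Nat.cast_zero, zero_sub, Polynomial.Chebyshev.U_neg_one, Polynomial.eval_zero]
  refine Finset.sum_congr rfl fun j hj => ?_
  rw [Nat.cast_sub (Finset.mem_range.mp hj).le]
  ring
end

section
/- Let n ∈ ℕ and let x ∈ ℝ with -1 ≤ x ≤ 1. Then the n-th derivative at t = 0 of t ↦ (2/(e^t + 1)) · exp(x t) · cos(√(1-x²) · t) equals Σ_{j=0}^{n} (n choose j) · T_j(x) · E_{n-j}, where E_m is the m-th derivative at t = 0 of t ↦ 2/(e^t + 1) and T_j is the Chebyshev polynomial of the first kind evaluated at x. (That is, the cosine-Euler polynomial satisfies E_n^{(C)}(x, √(1-x²)) = Σ_{j=0}^n (n choose j) T_j(x) E_{n-j}.) -/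
open Finset

lemma iteratedDeriv_exp_mul_cos (θ : ℝ) (n : ℕ) :
    iteratedDeriv n (fun t : ℝ => Real.exp (Real.cos θ * t) * Real.cos (Real.sin θ * t)) =
      fun t : ℝ => Real.exp (Real.cos θ * t) * Real.cos (Real.sin θ * t + n * θ) := by
  induction n with
  | zero => simp
  | succ n ih =>
    rw [iteratedDeriv_succ, ih]
    funext t
    have hexp : HasDerivAt (fun t : ℝ => Real.exp (Real.cos θ * t))
        (Real.exp (Real.cos θ * t) * (Real.cos θ * 1)) t :=
      ((hasDerivAt_id t).const_mul (Real.cos θ)).exp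
    have hcos : HasDerivAt (fun t : ℝ => Real.cos (Real.sin θ * t + n * θ))
        (-Real.sin (Real.sin θ * t + n * θ) * (Real.sin θ * 1)) t :=
      (((hasDerivAt_id t).const_mul (Real.sin θ)).add_const (n * θ)).cos
    rw [(hexp.fun_mul hcos).deriv]
    have hangle : Real.sin θ * t + ((n + 1 : ℕ) : ℝ) * θ = (Real.sin θ * t + n * θ) + θ := by
      push_cast
      ring
    rw [hangle, Real.cos_add _ θ]
    ring

theorem stmt_16 (n : ℕ) (x : ℝ) (hx : -1 ≤ x) (hx' : x ≤ 1) :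
    iteratedDeriv n
      (fun t : ℝ => 2 / (Real.exp t + 1) * Real.exp (x * t) *
        Real.cos (Real.sqrt (1 - x ^ 2) * t)) 0
    = ∑ j ∈ Finset.range (n + 1),
        (n.choose j : ℝ) * (Polynomial.Chebyshev.T ℝ j).eval x *
          iteratedDeriv (n - j) (fun t : ℝ => 2 / (Real.exp t + 1)) 0 := by
  obtain ⟨θ, rfl, hsin⟩ : ∃ θ : ℝ, Real.cos θ = x ∧ Real.sin θ = Real.sqrt (1 - x ^ 2) :=
    ⟨Real.arccos x, Real.cos_arccos hx hx', Real.sin_arccos x⟩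
  rw [← hsin]
  have hcomm : (fun t : ℝ => 2 / (Real.exp t + 1) * Real.exp (Real.cos θ * t) *
      Real.cos (Real.sin θ * t)) = fun t : ℝ =>
        Real.exp (Real.cos θ * t) * Real.cos (Real.sin θ * t) * (2 / (Real.exp t + 1)) := by
    funext t
    ring
  have hf : ContDiff ℝ n
      fun t : ℝ => Real.exp (Real.cos θ * t) * Real.cos (Real.sin θ * t) := by
    fun_prop
  have hg : ContDiff ℝ n fun t : ℝ => 2 / (Real.exp t + 1) :=
    contDiff_const.div (Real.contDiff_exp.add contDiff_const) fun t => by positivity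
  rw [hcomm, iteratedDeriv_fun_mul hf.contDiffAt hg.contDiffAt]
  refine Finset.sum_congr rfl fun j _ => ?_
  rw [iteratedDeriv_exp_mul_cos]
  simp [Polynomial.Chebyshev.T_real_cos]
end
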